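/- Let P = (X, d, x̄) and S = (X, δ, x̄) be presentations of a Polish space X with the same dense sequence, such that d and δ are equivalent metrics, i.e. there is N > 0 with (1/N)·d(x,y) ≤ δ(x,y) ≤ N·d(x,y) for all x, y ∈ X. Then φ_P(F) ≤ ω·(φ_S(F) + 1) (ordinal arithmetic) for every countable closed F ⊆ X. -/

import Mathlib

open Set Filter Topology

/-- A presentation `(X, d, x̄)` of a Polish space `X`: a complete metric `d`
compatible with the topology of `X`, together with a dense sequence `x̄`. -/
structure Presentation (X : Type) [TopologicalSpace X] where
  dist : X → X → ℝ
  seq : ℕ → X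
  dist_self : ∀ x, dist x x = 0
  eq_of_dist_eq_zero : ∀ x y, dist x y = 0 → x = y
  dist_comm : ∀ x y, dist x y = dist y x
  dist_triangle : ∀ x y z, dist x z ≤ dist x y + dist y z
  /-- `d` is compatible with the topology of `X`. -/
  isOpen_iff : ∀ s : Set X, IsOpen s ↔ ∀ x ∈ s, ∃ ε > 0, ∀ y, dist y x < ε → y ∈ s
  /-- `d` is complete. -/
  complete : ∀ u : ℕ → X, (∀ ε > 0, ∃ N, ∀ m ≥ N, ∀ n ≥ N, dist (u m) (u n) < ε) →
      ∃ x, ∀ ε > 0, ∃ N, ∀ n ≥ N, dist (u n) x < ε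
  /-- the sequence `x̄` is dense. -/
  dense : ∀ x, ∀ ε > 0, ∃ i, dist x (seq i) < ε

namespace Presentation

variable {X : Type} [TopologicalSpace X] (P : Presentation X)

/-- The open ball `B_P(n)`. -/
def ball (n : ℕ × ℕ) : Set X := {x | P.dist x (P.seq n.1) < (1/2 : ℝ) ^ (n.2 + 1)}

/-- The closed ball `B̄_P(n)`. -/
def cball (n : ℕ × ℕ) : Set X := {x | P.dist x (P.seq n.1) ≤ (1/2 : ℝ) ^ (n.2 + 1)}

/-- The relation `n ≺_P m`. -/
def prec (n m : ℕ × ℕ) : Prop := n.2 < m.2 ∧ P.cball m ⊆ P.ball n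

/-- The relation `n ⋏_P m`. -/
def apart (n m : ℕ × ℕ) : Prop := P.cball n ∩ P.cball m = ∅

/-- The code `A_F^P` of a closed set `F ⊆ X`. -/
def code (F : Set X) : Set (ℕ × ℕ) := {n | (P.ball n ∩ F).Nonempty}

/-- The derivative `D_P` on subsets of `ω × ω`. -/
def deriv (A : Set (ℕ × ℕ)) : Set (ℕ × ℕ) :=
  {n ∈ A | ∃ u ∈ A, ∃ v ∈ A, P.prec n u ∧ P.prec n v ∧ P.apart u v}

/-- The transfinite iterates `D_P^α(A)`. -/
noncomputable def derivIter (A : Set (ℕ × ℕ)) (α : Ordinal.{0}) : Set (ℕ × ℕ) :=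
  Ordinal.limitRecOn α A (fun _ ih => P.deriv ih)
    (fun o _ ih => ⋂ (β : {β : Ordinal.{0} // β < o}), ih β.1 β.2)

/-- The rank `|A|_P`: the least ordinal `α` with `D_P^α(A) = D_P^{α+1}(A)`. -/
noncomputable def rankA (A : Set (ℕ × ℕ)) : Ordinal.{0} :=
  sInf {α | P.derivIter A (α + 1) = P.derivIter A α}

/-- The rank `φ_P(F) = |A_F^P|_P` of a (countable closed) subset `F ⊆ X`. -/
noncomputable def phi (F : Set X) : Ordinal.{0} := P.rankA (P.code F)

/-- `A ⊆ ω × ω` is `P`-closed. -/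
def PClosed (A : Set (ℕ × ℕ)) : Prop := ∀ n ∈ A, ∀ m, P.prec m n → m ∈ A

/-- `A ⊆ ω × ω` is `P`-pruned. -/
def PPruned (A : Set (ℕ × ℕ)) : Prop := ∀ n ∈ A, ∃ m ∈ A, P.prec n m

/-- `A ⊆ ω × ω` is `P`-perfect. -/
def PPerfect (A : Set (ℕ × ℕ)) : Prop :=
  ∀ n ∈ A, ∃ u ∈ A, ∃ v ∈ A, P.prec n u ∧ P.prec n v ∧ P.apart u v

/-- The set `[A]_P` of `P`-compatible sequences lying in `A`. -/
def body (A : Set (ℕ × ℕ)) : Set (ℕ → ℕ × ℕ) :=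
  {f | (∀ i, P.prec (f i) (f (i + 1))) ∧ ∀ i, f i ∈ A}

/-- The set `F_A^P = π_P([A]_P)`: the points obtained as the unique point of
`⋂_i B_P(n_i)` for a `P`-compatible sequence `(n_i)` in `A`. -/
def limitSet (A : Set (ℕ × ℕ)) : Set X :=
  {x | ∃ f ∈ P.body A, ∀ i, x ∈ P.ball (f i)}

end Presentation

section CB

variable {X : Type} [TopologicalSpace X]

/-- The Cantor–Bendixson derivative: the set of limit points of `F` in `F`. -/
def cbDeriv (F : Set X) : Set X := {x ∈ F | AccPt x (𝓟 F)}

/-- The iterated Cantor–Bendixson derivatives `F^α`. -/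
noncomputable def cbIter (F : Set X) (α : Ordinal.{0}) : Set X :=
  Ordinal.limitRecOn α F (fun _ ih => cbDeriv ih)
    (fun o _ ih => ⋂ (β : {β : Ordinal.{0} // β < o}), ih β.1 β.2)

/-- The Cantor–Bendixson rank `|F|_CB`. -/
noncomputable def cbRank (F : Set X) : Ordinal.{0} :=
  sInf {α | cbIter F (α + 1) = cbIter F α}

/-- The `K_σ`-derivative of a subset `A ⊆ X`: the points of `A` having no open
neighborhood in the subspace `A` whose closure in `A` is compact. -/
def kDeriv (A : Set X) : Set X :=
  {x ∈ A | ∀ U : Set X, IsOpen U → x ∈ U → ¬ IsCompact (A ∩ closure (U ∩ A))}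

/-- The iterated `K_σ`-derivatives `X_α` of the space `X`. -/
noncomputable def kIter (X : Type) [TopologicalSpace X] (α : Ordinal.{0}) : Set X :=
  Ordinal.limitRecOn α Set.univ (fun _ ih => kDeriv ih)
    (fun o _ ih => ⋂ (β : {β : Ordinal.{0} // β < o}), ih β.1 β.2)

/-- The `K_σ`-rank `|X|_{K_σ}`. -/
noncomputable def kRank (X : Type) [TopologicalSpace X] : Ordinal.{0} :=
  sInf {α | kIter X (α + 1) = kIter X α}

end CB

namespace Presentation

variable {X : Type} [TopologicalSpace X] (P : Presentation X)

theorem half_pow_sub_add_one {k j : ℕ} (h : k ≤ j) :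
    (1 / 2 : ℝ) ^ (j - k + 1) = 2 ^ k * (1 / 2) ^ (j + 1) := by
  have h' : (2 : ℝ) ^ k * (1 / 2) ^ k = 1 := by rw [← mul_pow]; norm_num
  rw [show j + 1 = k + (j - k + 1) by omega, pow_add _ k, ← mul_assoc, h', one_mul]

theorem dist_nonneg (x y : X) : 0 ≤ P.dist x y := by
  have h := P.dist_triangle x y x
  rw [P.dist_self, P.dist_comm y x] at h
  linarith

theorem seq_mem_cball (n : ℕ × ℕ) : P.seq n.1 ∈ P.cball n := by
  simp only [cball, mem_ofPred_eq, P.dist_self]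
  positivity

theorem ball_subset_cball (n : ℕ × ℕ) : P.ball n ⊆ P.cball n := by
  intro x hx
  simp only [ball, cball, mem_ofPred_eq] at hx ⊢
  exact hx.le

theorem deriv_subset (A : Set (ℕ × ℕ)) : P.deriv A ⊆ A := fun _ hn => hn.1

/-- Closed balls are sequentially closed for the metric of the presentation. -/
theorem mem_cball_of_tendsto {n : ℕ × ℕ} {u : ℕ → X} {x : X}
    (hx : ∀ ε > 0, ∃ N, ∀ m ≥ N, P.dist (u m) x < ε)
    (hu : ∃ N, ∀ m ≥ N, u m ∈ P.cball n) : x ∈ P.cball n := by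
  rw [cball, mem_ofPred_eq]
  refine le_of_forall_pos_lt_add fun ε hε => ?_
  obtain ⟨N₁, h₁⟩ := hx ε hε
  obtain ⟨N₂, h₂⟩ := hu
  have h₃ := h₁ (max N₁ N₂) (le_max_left _ _)
  have h₄ : P.dist (u (max N₁ N₂)) (P.seq n.1) ≤ _ := h₂ (max N₁ N₂) (le_max_right _ _)
  have h₅ := P.dist_triangle x (u (max N₁ N₂)) (P.seq n.1)
  rw [P.dist_comm x (u _)] at h₅
  linarith

section Iterates

variable (A : Set (ℕ × ℕ))

theorem derivIter_zero : P.derivIter A 0 = A := by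
  simp [derivIter]

theorem derivIter_add_one (α : Ordinal.{0}) :
    P.derivIter A (α + 1) = P.deriv (P.derivIter A α) := by
  simp [derivIter]

theorem derivIter_limit {o : Ordinal.{0}} (ho : Order.IsSuccLimit o) :
    P.derivIter A o = ⋂ β : {β : Ordinal.{0} // β < o}, P.derivIter A β.1 := by
  unfold derivIter
  rw [Ordinal.limitRecOn_limit _ _ _ _ ho]

theorem derivIter_antitone : Antitone (P.derivIter A) := by
  intro α β
  induction β using Ordinal.limitRecOn with
  | zero =>
    intro h
    rw [nonpos_iff_eq_zero.mp h]
  | add_one β ih =>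
    intro h
    rcases h.eq_or_lt with rfl | h
    · exact le_rfl
    · rw [derivIter_add_one]
      exact (P.deriv_subset _).trans (ih (Order.lt_add_one_iff.mp h))
  | limit β hβ _ =>
    intro h
    rcases h.eq_or_lt with rfl | h
    · exact le_rfl
    · rw [P.derivIter_limit A hβ]
      exact iInter_subset (fun γ : {γ : Ordinal.{0} // γ < β} => P.derivIter A γ.1) ⟨α, h⟩

theorem deriv_derivIter_rankA :
    P.deriv (P.derivIter A (P.rankA A)) = P.derivIter A (P.rankA A) := by
  have hne : {α | P.derivIter A (α + 1) = P.derivIter A α}.Nonempty := by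
    have h := not_injective_of_ordinal (P.derivIter A)
    simp only [Function.Injective, not_forall] at h
    obtain ⟨a, b, hab, hne⟩ := h
    wlog hlt : a < b generalizing a b
    · exact this b a hab.symm (Ne.symm hne) (lt_of_le_of_ne (not_lt.mp hlt) (Ne.symm hne))
    refine ⟨a, le_antisymm (P.derivIter_antitone A le_self_add) ?_⟩
    rw [hab]
    exact P.derivIter_antitone A (Order.add_one_le_of_lt hlt)
  rw [← derivIter_add_one]
  exact csInf_mem hne

/-- A node surviving `m` further derivatives has a descendant `m` levels below it. -/
theorem exists_deep_of_mem_derivIter (γ : Ordinal.{0}) (m : ℕ) :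
    ∀ u ∈ P.derivIter A (γ + m),
      ∃ w ∈ P.derivIter A γ, m ≤ w.2 ∧ P.cball w ⊆ P.cball u := by
  suffices h : ∀ u ∈ P.derivIter A (γ + m),
      ∃ w ∈ P.derivIter A γ, u.2 + m ≤ w.2 ∧ P.cball w ⊆ P.cball u by
    intro u hu
    obtain ⟨w, hw, hm, hs⟩ := h u hu
    exact ⟨w, hw, by omega, hs⟩
  induction m with
  | zero =>
    intro u hu
    exact ⟨u, by simpa using hu, by simp, Subset.rfl⟩
  | succ m ih =>
    intro u hu
    rw [Nat.cast_succ, ← add_assoc, derivIter_add_one] at hu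
    obtain ⟨-, v, hv, -, -, huv, -, -⟩ := hu
    obtain ⟨w, hw, hm, hs⟩ := ih v hv
    have := huv.1
    exact ⟨w, hw, by omega, hs.trans (huv.2.trans (P.ball_subset_cball u))⟩

end Iterates

/-- A nonempty perfect set of nodes all meeting a closed set `F` forces `F` to be
uncountable. -/
theorem eq_empty_of_deriv_eq_self {F : Set X} (hF : IsClosed F) (hcnt : F.Countable)
    {A : Set (ℕ × ℕ)} (hA : A ⊆ P.code F) (hperf : P.deriv A = A) : A = ∅ := by
  by_contra hne
  obtain ⟨n₀, hn₀⟩ := nonempty_iff_ne_empty.mpr hne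
  obtain ⟨f, hf⟩ := hcnt.exists_eq_range ((hA hn₀).mono inter_subset_right)
  have step : ∀ (i : ℕ) (n : A), ∃ m : A, P.prec n m ∧ f i ∉ P.cball m := by
    rintro i ⟨n, hn⟩
    rw [← hperf] at hn
    obtain ⟨-, u, hu, v, hv, hnu, hnv, huv⟩ := hn
    by_cases h : f i ∈ P.cball u
    · refine ⟨⟨v, hv⟩, hnv, fun h' => ?_⟩
      have : f i ∈ P.cball u ∩ P.cball v := ⟨h, h'⟩
      rw [huv] at this
      exact this
    · exact ⟨⟨u, hu⟩, hnu, h⟩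
  choose g hg₁ hg₂ using step
  let s : ℕ → A := fun i => Nat.rec ⟨n₀, hn₀⟩ g i
  have hs : ∀ i, s (i + 1) = g i (s i) := fun _ => rfl
  have hanti : Antitone fun i => P.cball (s i).1 := by
    refine antitone_nat_of_succ_le fun i => ?_
    rw [hs]
    exact (hg₁ i (s i)).2.trans (P.ball_subset_cball _)
  have hlev : ∀ i, i ≤ (s i).1.2 := by
    intro i
    induction i with
    | zero => simp
    | succ i ih =>
      rw [hs]
      have := (hg₁ i (s i)).1
      omega
  choose y hyb hyF using fun i => hA (s i).2
  have hyc : ∀ i j, i ≤ j → y j ∈ P.cball (s i).1 := fun i j hij =>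
    hanti hij (P.ball_subset_cball _ (hyb j))
  have hsmall : ∀ ε > 0, ∃ N, (1 / 2 : ℝ) ^ ((s N).1.2 + 1) < ε := by
    intro ε hε
    obtain ⟨N, hN⟩ := exists_pow_lt_of_lt_one hε (by norm_num : (1 / 2 : ℝ) < 1)
    exact ⟨N, lt_of_le_of_lt
      (pow_le_pow_of_le_one (by norm_num) (by norm_num) ((hlev N).trans (Nat.le_succ _))) hN⟩
  obtain ⟨x, hx⟩ := P.complete y (by
    intro ε hε
    obtain ⟨N, hN⟩ := hsmall (ε / 2) (by positivity)
    refine ⟨N, fun m hm n hn => ?_⟩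
    have h₁ : P.dist (y m) _ ≤ _ := hyc N m hm
    have h₂ : P.dist (y n) _ ≤ _ := hyc N n hn
    have h₃ := P.dist_triangle (y m) (P.seq (s N).1.1) (y n)
    rw [P.dist_comm (P.seq _) (y n)] at h₃
    linarith)
  have hxF : x ∈ F := by
    by_contra hxF
    obtain ⟨ε, hε, h⟩ := (P.isOpen_iff Fᶜ).mp hF.isOpen_compl x hxF
    obtain ⟨N, hN⟩ := hx ε hε
    exact h (y N) (hN N le_rfl) (hyF N)
  rw [hf] at hxF
  obtain ⟨i, rfl⟩ := hxF
  apply hg₂ i (s i)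
  rw [← hs]
  exact P.mem_cball_of_tendsto hx ⟨i + 1, fun m hm => hyc _ m hm⟩

/-- If two nodes are `P`-apart, then sufficiently deep nodes centred in their closed balls
are still `S`-apart after enlarging their radii by the factor `2 ^ k`. -/
theorem exists_apart_of_apart {S : Presentation X} (hseq : S.seq = P.seq) {N : ℝ} (hN : 0 < N)
    (hle : ∀ x y : X, P.dist x y ≤ N * S.dist x y) (k : ℕ) {u v : ℕ × ℕ} (huv : P.apart u v)
    {a b : ℕ → ℕ × ℕ} (ha : ∀ m, P.seq (a m).1 ∈ P.cball u) (hb : ∀ m, P.seq (b m).1 ∈ P.cball v)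
    (ha' : ∀ m, m ≤ (a m).2) (hb' : ∀ m, m ≤ (b m).2) (m₀ : ℕ) :
    ∃ m ≥ m₀, ∃ m' ≥ m₀, S.apart ((a m).1, (a m).2 - k) ((b m').1, (b m').2 - k) := by
  by_contra! hcon
  have hdist : ∀ m ≥ m₀, ∀ m' ≥ m₀, P.dist (P.seq (a m).1) (P.seq (b m').1) ≤
      N * 2 ^ k * ((1 / 2) ^ m + (1 / 2) ^ m') := by
    intro m hm m' hm'
    obtain ⟨y, hy₁, hy₂⟩ := nonempty_iff_ne_empty.mpr (hcon m hm m' hm')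
    simp only [cball, mem_ofPred_eq, hseq] at hy₁ hy₂
    have hpow : ∀ p q : ℕ, p ≤ q → (1 / 2 : ℝ) ^ (q - k + 1) ≤ 2 ^ k * (1 / 2) ^ p := by
      intro p q hpq
      have h : (2 : ℝ) ^ k * (1 / 2) ^ k = 1 := by rw [← mul_pow]; norm_num
      calc (1 / 2 : ℝ) ^ (q - k + 1) = 2 ^ k * (1 / 2) ^ (k + (q - k + 1)) := by
            rw [pow_add _ k, ← mul_assoc, h, one_mul]
        _ ≤ 2 ^ k * (1 / 2) ^ p := by
            gcongr ?_ * ?_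
            exact pow_le_pow_of_le_one (by norm_num) (by norm_num) (by omega)
    have h₁ := S.dist_triangle (P.seq (a m).1) y (P.seq (b m').1)
    rw [S.dist_comm _ y] at h₁
    calc _ ≤ N * S.dist (P.seq (a m).1) (P.seq (b m').1) := hle _ _
      _ ≤ N * (2 ^ k * (1 / 2) ^ m + 2 ^ k * (1 / 2) ^ m') := by
          gcongr
          exact h₁.trans (add_le_add (hy₁.trans (hpow _ _ (ha' m))) (hy₂.trans (hpow _ _ (hb' m'))))
      _ = _ := by ring
  have hsmall : ∀ ε > 0, ∃ M ≥ m₀, ∀ m ≥ M, ∀ m' ≥ M,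
      P.dist (P.seq (a m).1) (P.seq (b m').1) < ε := by
    intro ε hε
    have hC : 0 < N * 2 ^ k := by positivity
    obtain ⟨M, hM⟩ := exists_pow_lt_of_lt_one (show 0 < ε / (N * 2 ^ k) / 2 by positivity)
      (by norm_num : (1 / 2 : ℝ) < 1)
    refine ⟨max M m₀, le_max_right _ _, fun m hm m' hm' => ?_⟩
    have hp : ∀ p ≥ max M m₀, (1 / 2 : ℝ) ^ p < ε / (N * 2 ^ k) / 2 := fun p hp =>
      (pow_le_pow_of_le_one (by norm_num) (by norm_num) ((le_max_left _ _).trans hp)).trans_lt hM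
    refine (hdist m ((le_max_right _ _).trans hm) m' ((le_max_right _ _).trans hm')).trans_lt ?_
    rw [← lt_div_iff₀' hC]
    linarith [hp m hm, hp m' hm']
  obtain ⟨x, hx⟩ := P.complete (fun m => P.seq (a m).1) (by
    intro ε hε
    obtain ⟨M, -, hM⟩ := hsmall (ε / 2) (by positivity)
    refine ⟨M, fun m hm n hn => ?_⟩
    have h₁ := P.dist_triangle (P.seq (a m).1) (P.seq (b M).1) (P.seq (a n).1)
    rw [P.dist_comm (P.seq (b M).1)] at h₁
    linarith [hM m hm M le_rfl, hM n hn M le_rfl])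
  have hx' : ∀ ε > 0, ∃ M, ∀ m ≥ M, P.dist (P.seq (b m).1) x < ε := by
    intro ε hε
    obtain ⟨M, -, hM⟩ := hsmall (ε / 2) (by positivity)
    obtain ⟨M', hM'⟩ := hx (ε / 2) (by positivity)
    refine ⟨max M M', fun m hm => ?_⟩
    have h₁ := P.dist_triangle (P.seq (b m).1) (P.seq (a m).1) x
    rw [P.dist_comm (P.seq (b m).1) (P.seq (a m).1)] at h₁
    linarith [hM m ((le_max_left _ _).trans hm) m ((le_max_left _ _).trans hm),
      hM' m ((le_max_right _ _).trans hm)]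
  have hmem : x ∈ P.cball u ∩ P.cball v :=
    ⟨P.mem_cball_of_tendsto hx ⟨0, fun m _ => ha m⟩, P.mem_cball_of_tendsto hx' ⟨0, fun m _ => hb m⟩⟩
  rw [huv] at hmem
  exact hmem

/-- Enlarging a `P`-ball by the factor `2 ^ k` gives an `S`-ball that contains it, with room
to spare for the enlargements of deeper balls. -/
theorem prec_enlarge {S : Presentation X} (hseq : S.seq = P.seq) {N : ℝ}
    (hle : ∀ x y : X, S.dist x y ≤ N * P.dist x y) {k : ℕ} (hk : 2 * N ≤ 2 ^ k)
    {n w : ℕ × ℕ} (hn : k ≤ n.2) (hw : n.2 < w.2) (hwn : P.seq w.1 ∈ P.ball n) :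
    S.prec (n.1, n.2 - k) (w.1, w.2 - k) := by
  refine ⟨by simp only; omega, fun y hy => ?_⟩
  simp only [cball, ball, mem_ofPred_eq, hseq] at hy hwn ⊢
  have h₁ := S.dist_triangle y (P.seq w.1) (P.seq n.1)
  have h₂ := hle (P.seq w.1) (P.seq n.1)
  have h₃ : (1 / 2 : ℝ) ^ (w.2 - k + 1) ≤ (1 / 2) ^ (n.2 - k + 1) / 2 := by
    calc (1 / 2 : ℝ) ^ (w.2 - k + 1) ≤ (1 / 2) ^ (n.2 - k + 1 + 1) :=
          pow_le_pow_of_le_one (by norm_num) (by norm_num) (by omega)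
      _ = _ := by rw [pow_succ]; ring
  have h₄ := half_pow_sub_add_one hn
  have h₅ : 2 * N * P.dist (P.seq w.1) (P.seq n.1) < 2 ^ k * (1 / 2) ^ (n.2 + 1) :=
    (mul_le_mul_of_nonneg_right hk (P.dist_nonneg _ _)).trans_lt
      (mul_lt_mul_of_pos_left hwn (by positivity))
  linarith

theorem enlarge_mem_code {S : Presentation X} (hseq : S.seq = P.seq) {N : ℝ}
    (hle : ∀ x y : X, S.dist x y ≤ N * P.dist x y) {k : ℕ} (hk : N ≤ 2 ^ k) {F : Set X}
    {n : ℕ × ℕ} (hn : k ≤ n.2) (hnF : n ∈ P.code F) : (n.1, n.2 - k) ∈ S.code F := by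
  obtain ⟨y, hy, hyF⟩ := hnF
  refine ⟨y, ?_, hyF⟩
  simp only [ball, mem_ofPred_eq, hseq] at hy ⊢
  rw [half_pow_sub_add_one hn]
  exact ((hle _ _).trans (mul_le_mul_of_nonneg_right hk (P.dist_nonneg _ _))).trans_lt
    (mul_lt_mul_of_pos_left hy (by positivity))

/-- Comparison of the iterated derivatives of the codes of `F` for equivalent metrics. -/
theorem enlarge_mem_derivIter {S : Presentation X} (hseq : S.seq = P.seq) {N : ℝ} (hN : 0 < N)
    (hle : ∀ x y : X, S.dist x y ≤ N * P.dist x y) (hle' : ∀ x y : X, P.dist x y ≤ N * S.dist x y)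
    {k : ℕ} (hk : 2 * N ≤ 2 ^ k) (F : Set X) (α : Ordinal.{0}) :
    ∀ n ∈ P.derivIter (P.code F) (Ordinal.omega0 * α + 1), k ≤ n.2 →
      (n.1, n.2 - k) ∈ S.derivIter (S.code F) α := by
  induction α using Ordinal.limitRecOn with
  | zero =>
    intro n hn hkn
    rw [derivIter_zero]
    have hn' := P.derivIter_antitone (P.code F) (zero_le) hn
    rw [derivIter_zero] at hn'
    exact P.enlarge_mem_code hseq hle (by linarith) hkn hn'
  | add_one α ih =>
    intro n hn hkn
    have hmem : (n.1, n.2 - k) ∈ S.derivIter (S.code F) α :=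
      ih n (P.derivIter_antitone _ (by gcongr; exact le_self_add) hn) hkn
    rw [derivIter_add_one] at hn ⊢
    obtain ⟨-, u, hu, v, hv, hnu, hnv, huv⟩ := hn
    have hdeep : ∀ w ∈ P.derivIter (P.code F) (Ordinal.omega0 * (α + 1)), ∀ m : ℕ,
        ∃ z ∈ P.derivIter (P.code F) (Ordinal.omega0 * α + 1), m ≤ z.2 ∧
          P.cball z ⊆ P.cball w := by
      intro w hw m
      refine P.exists_deep_of_mem_derivIter _ _ m w (P.derivIter_antitone _ ?_ hw)
      rw [mul_add_one, add_assoc]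
      gcongr
      exact_mod_cast (Ordinal.natCast_lt_omega0 (1 + m)).le
    choose a ha ha' hau using hdeep u hu
    choose b hb hb' hbv using hdeep v hv
    obtain ⟨m, hm, m', hm', hap⟩ := P.exists_apart_of_apart hseq hN hle' k huv
      (fun m => hau m (P.seq_mem_cball _)) (fun m => hbv m (P.seq_mem_cball _)) ha' hb' (n.2 + 1)
    have := ha' m
    have := hb' m'
    exact ⟨hmem, _, ih _ (ha m) (by omega), _, ih _ (hb m') (by omega),
      P.prec_enlarge hseq hle hk hkn (by omega) (hnu.2 (hau m (P.seq_mem_cball _))),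
      P.prec_enlarge hseq hle hk hkn (by omega) (hnv.2 (hbv m' (P.seq_mem_cball _))), hap⟩
  | limit α hα ih =>
    intro n hn hkn
    rw [S.derivIter_limit _ hα, mem_iInter]
    rintro ⟨β, hβ⟩
    exact ih β hβ n (P.derivIter_antitone _ (by gcongr) hn) hkn

end Presentation

/-- If `P` and `S` share the dense sequence and their metrics are
equivalent (`(1/N)·d ≤ δ ≤ N·d`), then `φ_P(F) ≤ ω·(φ_S(F) + 1)` on countable
closed sets. -/
theorem stmt13 {X : Type} [TopologicalSpace X] [PolishSpace X]
    (P S : Presentation X) (hseq : S.seq = P.seq)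
    (N : ℝ) (hN : 0 < N)
    (hequiv : ∀ x y : X, (1 / N) * P.dist x y ≤ S.dist x y ∧ S.dist x y ≤ N * P.dist x y)
    (F : Set X) (hF : IsClosed F) (hcnt : F.Countable) :
    P.phi F ≤ Ordinal.omega0 * (S.phi F + 1) := by
  have hle : ∀ x y : X, S.dist x y ≤ N * P.dist x y := fun x y => (hequiv x y).2
  have hle' : ∀ x y : X, P.dist x y ≤ N * S.dist x y := fun x y => by
    have h := (hequiv x y).1
    rwa [one_div, inv_mul_le_iff₀ hN] at h
  obtain ⟨k, hk⟩ := pow_unbounded_of_one_lt (2 * N) (by norm_num : (1 : ℝ) < 2)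
  have hS : S.derivIter (S.code F) (S.phi F) = ∅ := by
    refine S.eq_empty_of_deriv_eq_self hF hcnt ?_ (S.deriv_derivIter_rankA _)
    have h := S.derivIter_antitone (S.code F) (zero_le : 0 ≤ S.phi F)
    rwa [S.derivIter_zero] at h
  have hP : P.derivIter (P.code F) (Ordinal.omega0 * S.phi F + 1 + k) = ∅ := by
    refine eq_empty_of_forall_notMem fun n hn => ?_
    obtain ⟨w, hw, hkw, -⟩ := P.exists_deep_of_mem_derivIter _ _ k n hn
    have h := P.enlarge_mem_derivIter hseq hN hle hle' hk.le F (S.phi F) w hw hkw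
    rw [hS] at h
    exact h
  have hrank : P.phi F ≤ Ordinal.omega0 * S.phi F + 1 + k := by
    refine csInf_le' ?_
    rw [mem_ofPred_eq, P.derivIter_add_one, hP]
    exact subset_empty_iff.mp (P.deriv_subset ∅)
  refine hrank.trans ?_
  rw [mul_add_one, add_assoc]
  gcongr
  exact_mod_cast (Ordinal.natCast_lt_omega0 (1 + k)).le
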